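/- arXiv:2402.05051 — 4 statements merged into one kernel-verified Lean document; each statement's English description precedes it below -/
import Mathlib

section
/- Let l : (S,≤) → (T,≲) be a length function between posets, i.e., l satisfies (L1) x < y implies l(x) < l(y), (L2) any two values of l are ≲-comparable, and (L3) for every y ∈ S the set {l(x') : x' ∈ S, x' ≤ y} is finite. Then for every x ∈ S, the set {l(X) : X ∈ Ch(S), max X = x} ⊆ Ch(T) is finite and totally ordered by the lexicographic order ≤_L, and it possesses a ≤_L-greatest element; in particular the induced chain length function l*(x) = max{l(X) : X ∈ Ch(S), max X = x} is well defined. -/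
open scoped Classical

namespace GR

variable {S : Type*} {T : Type*} [PartialOrder S] [PartialOrder T]

/-- The lexicographic order on finite chains of a poset `T`:
`X ≤ₗ Y` iff `min (Y \ X) ≤ min (X \ Y)`, with the convention
`max ∅ < t < min ∅` for every `t`. -/
def LexLE (X Y : Finset T) : Prop :=
  X \ Y = ∅ ∨ ∃ y ∈ Y \ X, ∀ x ∈ X \ Y, y ≤ x

/-- `C` is a finite chain in the poset `S`. -/
def IsFinChain (C : Finset S) : Prop := ∀ x ∈ C, ∀ y ∈ C, x ≤ y ∨ y ≤ x

/-- `x` is the maximum of the finite set `C`. -/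
def HasMax (C : Finset S) (x : S) : Prop := x ∈ C ∧ ∀ y ∈ C, y ≤ x

/-- The set `{l(X) : X ∈ Ch(S), max X = x}` of images under `l` of finite chains
with maximum `x`. -/
def chainImages (l : S → T) (x : S) : Set (Finset T) :=
  {Z | ∃ C : Finset S, IsFinChain C ∧ HasMax C x ∧ C.image l = Z}

/-- A filtration of `x`: a finite chain starting at a minimal element, each member a direct
predecessor (i.e. covered by) the next, and ending at `x`. -/
def IsFiltrationOf {k : ℕ} (F : Fin (k + 1) → S) (x : S) : Prop :=
  IsMin (F 0) ∧ (∀ i : Fin k, F i.castSucc ⋖ F i.succ) ∧ F (Fin.last k) = x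

/-- The set of images under `l` of filtrations of `x`. -/
def filtImages (l : S → T) (x : S) : Set (Finset T) :=
  {Z | ∃ (k : ℕ) (F : Fin (k + 1) → S), IsFiltrationOf F x ∧
    (Finset.image F Finset.univ).image l = Z}

/-- `Z` is the value `l*(x)` of the induced chain length function, i.e. the
`≤ₗ`-greatest element of `{l(X) : X ∈ Ch(S), max X = x}`. -/
def IsGRValue (l : S → T) (x : S) (Z : Finset T) : Prop :=
  Z ∈ chainImages l x ∧ ∀ Z' ∈ chainImages l x, LexLE Z' Z

end GR

namespace GR

/-- Either two finite sets coincide, or the least element of their symmetric difference exists,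
provided that all their elements are pairwise comparable. -/
theorem eq_or_exists_least_symmDiff {T : Type*} [PartialOrder T] {R : Set T}
    (hR : ∀ a ∈ R, ∀ b ∈ R, a ≤ b ∨ b ≤ a) {X Y : Finset T} (hX : ↑X ⊆ R) (hY : ↑Y ⊆ R) :
    X = Y ∨ ∃ m, (m ∈ X \ Y ∨ m ∈ Y \ X) ∧ ∀ a, a ∈ X \ Y ∨ a ∈ Y \ X → m ≤ a := by
  rcases (X \ Y ∪ Y \ X).eq_empty_or_nonempty with h | h
  · left
    rw [Finset.union_eq_empty, Finset.sdiff_eq_empty_iff_subset,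
      Finset.sdiff_eq_empty_iff_subset] at h
    exact h.1.antisymm h.2
  · right
    obtain ⟨m, hm, hmin⟩ := Finset.exists_minimal h
    have hsub : ∀ a ∈ X \ Y ∪ Y \ X, a ∈ R := by
      intro a ha
      simp only [Finset.mem_union, Finset.mem_sdiff] at ha
      exact ha.elim (fun h => hX h.1) (fun h => hY h.1)
    refine ⟨m, Finset.mem_union.1 hm, fun a ha => ?_⟩
    have ha := Finset.mem_union.2 ha
    exact (hR m (hsub m hm) a (hsub a ha)).elim id (hmin ha)

theorem LexLE.total {T : Type*} [PartialOrder T] {R : Set T}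
    (hR : ∀ a ∈ R, ∀ b ∈ R, a ≤ b ∨ b ≤ a) {X Y : Finset T} (hX : ↑X ⊆ R) (hY : ↑Y ⊆ R) :
    LexLE X Y ∨ LexLE Y X := by
  rcases eq_or_exists_least_symmDiff hR hX hY with rfl | ⟨m, hm | hm, hmin⟩
  · exact .inl (.inl (Finset.sdiff_self X))
  · exact .inr (.inr ⟨m, hm, fun a ha => hmin a (.inr ha)⟩)
  · exact .inl (.inr ⟨m, hm, fun a ha => hmin a (.inl ha)⟩)

theorem LexLE.antisymm {T : Type*} [PartialOrder T] {X Y : Finset T}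
    (hXY : LexLE X Y) (hYX : LexLE Y X) : X = Y := by
  rcases hXY with hXY | ⟨y, hy, hyle⟩ <;> rcases hYX with hYX | ⟨x, hx, hxle⟩
  · exact (Finset.sdiff_eq_empty_iff_subset.1 hXY).antisymm
      (Finset.sdiff_eq_empty_iff_subset.1 hYX)
  · simp [hXY] at hx
  · simp [hYX] at hy
  · have := (hyle x hx).antisymm (hxle y hy)
    grind

theorem LexLE.trans {T : Type*} [PartialOrder T] {R : Set T}
    (hR : ∀ a ∈ R, ∀ b ∈ R, a ≤ b ∨ b ≤ a) {X Y Z : Finset T} (hX : ↑X ⊆ R) (hZ : ↑Z ⊆ R)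
    (hXY : LexLE X Y) (hYZ : LexLE Y Z) : LexLE X Z := by
  rcases eq_or_exists_least_symmDiff hR hX hZ with rfl | ⟨m, hm | hm, hmin⟩
  · exact .inl (Finset.sdiff_self X)
  · exfalso
    have lt_iff : ∀ a, a ≤ m → a ≠ m → (a ∈ X ↔ a ∈ Z) := by
      intro a ha hne
      by_contra hcon
      exact hne (ha.antisymm (hmin a (by grind)))
    simp only [LexLE, Finset.sdiff_eq_empty_iff_subset, Finset.subset_iff,
      Finset.mem_sdiff] at hXY hYZ hm
    by_cases hmY : m ∈ Y
    · obtain h | ⟨z, hz, hzle⟩ := hYZ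
      · exact hm.2 (h hmY)
      have hzm := hzle m ⟨hmY, hm.2⟩
      have hzX : z ∈ X := (lt_iff z hzm (by grind)).2 hz.1
      obtain h | ⟨y, hy, hyle⟩ := hXY
      · exact hz.2 (h hzX)
      have hyz := hyle z ⟨hzX, hz.2⟩
      have hyZ : y ∉ Z := fun h => hy.2 ((lt_iff y (hyz.trans hzm) (by grind)).2 h)
      have := hyz.antisymm (hzle y ⟨hy.1, hyZ⟩)
      exact hz.2 (this ▸ hy.1)
    · obtain h | ⟨y, hy, hyle⟩ := hXY
      · exact hmY (h hm.1)
      have hym := hyle m ⟨hm.1, hmY⟩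
      have hyZ : y ∉ Z := fun h => hy.2 ((lt_iff y hym (by grind)).2 h)
      obtain h | ⟨z, hz, hzle⟩ := hYZ
      · exact hyZ (h hy.1)
      have hzy := hzle y ⟨hy.1, hyZ⟩
      have hzX : z ∈ X := (lt_iff z (hzy.trans hym) (by grind)).2 hz.1
      have := hzy.antisymm (hyle z ⟨hzX, hz.2⟩)
      exact hyZ (this ▸ hz.1)
  · exact .inr ⟨m, hm, fun a ha => hmin a (.inl ha)⟩

theorem chainImages_nonempty {S T : Type*} [PartialOrder S] [PartialOrder T] (l : S → T) (x : S) :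
    (chainImages l x).Nonempty :=
  ⟨_, {x}, by simp [IsFinChain], by simp [HasMax], rfl⟩

theorem subset_of_mem_chainImages {S T : Type*} [PartialOrder S] [PartialOrder T] {l : S → T}
    {x : S} {Z : Finset T} (hZ : Z ∈ chainImages l x) :
    (Z : Set T) ⊆ {t | ∃ y, y ≤ x ∧ l y = t} := by
  obtain ⟨C, -, hC, rfl⟩ := hZ
  intro t ht
  obtain ⟨y, hy, rfl⟩ := Finset.mem_image.1 (Finset.mem_coe.1 ht)
  exact ⟨y, hC.2 y hy, rfl⟩

end GR

theorem stmt3 {S : Type*} {T : Type*} [PartialOrder S] [PartialOrder T] (l : S → T)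
    (hL1 : ∀ x y : S, x < y → l x < l y)
    (hL2 : ∀ x y : S, l x ≤ l y ∨ l y ≤ l x)
    (hL3 : ∀ y : S, {t : T | ∃ x : S, x ≤ y ∧ l x = t}.Finite)
    (x : S) :
    (GR.chainImages l x).Finite ∧
    (∀ Z₁ ∈ GR.chainImages l x, ∀ Z₂ ∈ GR.chainImages l x,
      GR.LexLE Z₁ Z₂ ∨ GR.LexLE Z₂ Z₁) ∧
    (∀ Z₁ ∈ GR.chainImages l x, ∀ Z₂ ∈ GR.chainImages l x,
      GR.LexLE Z₁ Z₂ → GR.LexLE Z₂ Z₁ → Z₁ = Z₂) ∧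
    (∀ Z₁ ∈ GR.chainImages l x, ∀ Z₂ ∈ GR.chainImages l x, ∀ Z₃ ∈ GR.chainImages l x,
      GR.LexLE Z₁ Z₂ → GR.LexLE Z₂ Z₃ → GR.LexLE Z₁ Z₃) ∧
    ∃ Z ∈ GR.chainImages l x, ∀ Z' ∈ GR.chainImages l x, GR.LexLE Z' Z := by
  have hR : ∀ a ∈ {t | ∃ y, y ≤ x ∧ l y = t}, ∀ b ∈ {t | ∃ y, y ≤ x ∧ l y = t},
      a ≤ b ∨ b ≤ a := by
    rintro _ ⟨a, -, rfl⟩ _ ⟨b, -, rfl⟩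
    exact hL2 a b
  have hfin : (GR.chainImages l x).Finite :=
    ((hL3 x).toFinset.powerset.finite_toSet).subset fun Z hZ => by
      simpa [← Finset.coe_subset] using GR.subset_of_mem_chainImages hZ
  have htotal : ∀ Z₁ ∈ GR.chainImages l x, ∀ Z₂ ∈ GR.chainImages l x,
      GR.LexLE Z₁ Z₂ ∨ GR.LexLE Z₂ Z₁ := fun _ h₁ _ h₂ =>
    GR.LexLE.total hR (GR.subset_of_mem_chainImages h₁) (GR.subset_of_mem_chainImages h₂)
  have htrans : ∀ Z₁ ∈ GR.chainImages l x, ∀ Z₂ ∈ GR.chainImages l x,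
      ∀ Z₃ ∈ GR.chainImages l x, GR.LexLE Z₁ Z₂ → GR.LexLE Z₂ Z₃ → GR.LexLE Z₁ Z₃ :=
    fun _ h₁ _ _ _ h₃ =>
      GR.LexLE.trans hR (GR.subset_of_mem_chainImages h₁) (GR.subset_of_mem_chainImages h₃)
  refine ⟨hfin, htotal, fun _ _ _ _ => GR.LexLE.antisymm, htrans, ?_⟩
  let r : GR.chainImages l x → GR.chainImages l x → Prop := fun A B => GR.LexLE A.1 B.1
  have : IsTrans _ r := ⟨fun A B C => htrans A A.2 B B.2 C C.2⟩
  have : Finite (GR.chainImages l x) := hfin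
  have : Nonempty (GR.chainImages l x) := (GR.chainImages_nonempty l x).to_subtype
  have hrefl : ∀ A, r A A := fun A => .inl (Finset.sdiff_self A.1)
  have hdir : Directed r id := fun A B =>
    (htotal A A.2 B B.2).elim (fun h => ⟨B, h, hrefl B⟩) (fun h => ⟨A, hrefl A, h⟩)
  obtain ⟨Z, hZ⟩ := hdir.finite_le id
  exact ⟨Z, Z.2, fun Z' hZ' => hZ ⟨Z', hZ'⟩⟩
end

section
/- Let l : (S,≤) → (T,≲) be a length function between posets, i.e., l satisfies (L1) x < y implies l(x) < l(y), (L2) any two values of l are ≲-comparable, and (L3) for every y ∈ S the set {l(x') : x' ∈ S, x' ≤ y} is finite. Then for every x ∈ S and every finite chain C in S with max C = x, there exists a filtration F of x with C ⊆ F, and consequently l(C) ≤_L l(F); in particular l*(x) = max{l(X) : X ∈ Ch(S), max X = x} equals max{l(F) : F a filtration of x}, so in the definition of l* it suffices to consider only filtrations of x. -/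
open scoped Classical

namespace GR

section Filtration

variable {S T : Type*} [PartialOrder S] [PartialOrder T]

theorem LexLE.of_subset {X Y : Finset T} (h : X ⊆ Y) : LexLE X Y :=
  Or.inl (Finset.sdiff_eq_empty_iff_subset.2 h)

theorem LexLE.mono_left {X Y Z : Finset T} (hXY : X ⊆ Y) (hYZ : LexLE Y Z) : LexLE X Z := by
  rcases hYZ with h | ⟨z, hz, hmin⟩
  · exact LexLE.of_subset (hXY.trans (Finset.sdiff_eq_empty_iff_subset.1 h))
  · rw [Finset.mem_sdiff] at hz
    exact Or.inr ⟨z, Finset.mem_sdiff.2 ⟨hz.1, fun h => hz.2 (hXY h)⟩,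
      fun x hx => hmin x (Finset.sdiff_subset_sdiff hXY subset_rfl hx)⟩

theorem LexLE.antisymm_of_subset {X Y : Finset T} (hXY : X ⊆ Y) (hYX : LexLE Y X) : X = Y := by
  rcases hYX with h | ⟨y, hy, -⟩
  · exact hXY.antisymm (Finset.sdiff_eq_empty_iff_subset.1 h)
  · rw [Finset.mem_sdiff] at hy
    exact absurd (hXY hy.1) hy.2

theorem IsFiltrationOf.strictMono {k : ℕ} {F : Fin (k + 1) → S} {x : S}
    (hF : IsFiltrationOf F x) : StrictMono F :=
  Fin.strictMono_iff_lt_succ.2 fun i => (hF.2.1 i).lt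

theorem IsFiltrationOf.snoc {k : ℕ} {F : Fin (k + 1) → S} {x y : S}
    (hF : IsFiltrationOf F y) (hyx : y ⋖ x) :
    IsFiltrationOf (Fin.snoc F x : Fin (k + 1 + 1) → S) x := by
  refine ⟨?_, fun i => ?_, Fin.snoc_last (α := fun _ => S) x F⟩
  · rw [← Fin.castSucc_zero, Fin.snoc_castSucc (α := fun _ => S)]
    exact hF.1
  · induction i using Fin.lastCases with
    | last =>
      rw [Fin.snoc_castSucc (α := fun _ => S), Fin.succ_last, Fin.snoc_last (α := fun _ => S),
        hF.2.2]
      exact hyx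
    | cast j =>
      rw [Fin.snoc_castSucc (α := fun _ => S), Fin.succ_castSucc,
        Fin.snoc_castSucc (α := fun _ => S)]
      exact hF.2.1 j

theorem filtImages_subset_chainImages {R : Type*} (l : S → R) (x : S) :
    filtImages l x ⊆ chainImages l x := by
  rintro Z ⟨k, F, hF, rfl⟩
  refine ⟨Finset.image F Finset.univ, ?_, ⟨?_, ?_⟩, rfl⟩
  · intro a ha b hb
    simp only [Finset.mem_image, Finset.mem_univ, true_and] at ha hb
    obtain ⟨i, rfl⟩ := ha
    obtain ⟨j, rfl⟩ := hb
    exact (le_total i j).imp (fun h => hF.strictMono.monotone h) fun h => hF.strictMono.monotone h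
  · exact Finset.mem_image.2 ⟨Fin.last k, Finset.mem_univ _, hF.2.2⟩
  · intro a ha
    simp only [Finset.mem_image, Finset.mem_univ, true_and] at ha
    obtain ⟨i, rfl⟩ := ha
    rw [← hF.2.2]
    exact hF.strictMono.monotone (Fin.le_last i)

/-- If a strictly monotone map takes only finitely many values below each element, then the
order of its source is well-founded. -/
theorem wellFounded_lt_of_finite_values {l : S → T} (hl : StrictMono l)
    (hfin : ∀ y : S, (l '' Set.Iic y).Finite) : WellFounded ((· < ·) : S → S → Prop) := by
  refine Subrelation.wf (fun {y x} hyx => ?_)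
    (InvImage.wf (fun y => (l '' Set.Iic y).ncard) Nat.lt_wfRel.wf)
  refine Set.ncard_lt_ncard ⟨Set.image_mono (Set.Iic_subset_Iic.2 hyx.le), fun h => ?_⟩ (hfin x)
  obtain ⟨z, hz, hzx⟩ := h ⟨x, Set.self_mem_Iic, rfl⟩
  exact (hl (lt_of_le_of_lt hz hyx)).ne hzx

/-- A finite chain strictly below a non-minimal element `x` is bounded by a direct predecessor
of `x`. -/
theorem exists_covBy_of_isFinChain {l : S → T} (hl : StrictMono l)
    (hfin : ∀ y : S, (l '' Set.Iic y).Finite) {x : S} (hx : ¬ IsMin x) {C : Finset S}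
    (hC : IsFinChain C) (hCx : ∀ c ∈ C, c < x) : ∃ y, y ⋖ x ∧ ∀ c ∈ C, c ≤ y := by
  let U : Set S := {y | y < x ∧ ∀ c ∈ C, c ≤ y}
  have hne : U.Nonempty := by
    rcases C.eq_empty_or_nonempty with rfl | hCne
    · obtain ⟨y, hy⟩ := not_isMin_iff.1 hx
      exact ⟨y, hy, by simp⟩
    · obtain ⟨m, hm⟩ := C.exists_maximal hCne
      exact ⟨m, hCx m hm.prop, fun c hc => (hC c hc m hm.prop).elim id fun h => hm.le_of_ge hc h⟩
  have hUfin : (l '' U).Finite := (hfin x).subset (Set.image_mono fun y hy => hy.1.le)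
  obtain ⟨t, ht⟩ := hUfin.exists_maximal (hne.image l)
  obtain ⟨y, hy, rfl⟩ := ht.prop
  refine ⟨y, ⟨hy.1, fun z hyz hzx => ?_⟩, hy.2⟩
  exact ht.not_gt ⟨z, ⟨hzx, fun c hc => (hy.2 c hc).trans hyz.le⟩, rfl⟩ (hl hyz)

/-- Every finite chain with maximum `x` refines to a filtration of `x`. -/
theorem exists_isFiltrationOf_of_isFinChain {l : S → T} (hl : StrictMono l)
    (hfin : ∀ y : S, (l '' Set.Iic y).Finite) (x : S) (C : Finset S) (hC : IsFinChain C)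
    (hCx : HasMax C x) :
    ∃ (k : ℕ) (F : Fin (k + 1) → S), IsFiltrationOf F x ∧ ↑C ⊆ Set.range F := by
  induction x using (wellFounded_lt_of_finite_values hl hfin).induction generalizing C with
  | _ x ih =>
  by_cases hx : IsMin x
  · exact ⟨0, fun _ => x, ⟨hx, fun i => i.elim0, rfl⟩,
      fun c hc => ⟨0, hx.eq_of_ge (hCx.2 c hc)⟩⟩
  · have hCe : IsFinChain (C.erase x) := fun a ha b hb =>
      hC a (Finset.mem_of_mem_erase ha) b (Finset.mem_of_mem_erase hb)
    obtain ⟨y, hyx, hy⟩ := exists_covBy_of_isFinChain hl hfin hx hCe fun c hc =>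
      lt_of_le_of_ne (hCx.2 c (Finset.mem_of_mem_erase hc)) (Finset.ne_of_mem_erase hc)
    have hmax : HasMax (insert y (C.erase x)) y := by
      refine ⟨Finset.mem_insert_self _ _, fun c hc => ?_⟩
      rcases Finset.mem_insert.1 hc with rfl | hc
      exacts [le_rfl, hy c hc]
    have hchain : IsFinChain (insert y (C.erase x)) := by
      intro a ha b hb
      rcases Finset.mem_insert.1 ha with rfl | ha'
      · exact Or.inr (hmax.2 b hb)
      rcases Finset.mem_insert.1 hb with rfl | hb'
      · exact Or.inl (hmax.2 a ha)
      exact hCe a ha' b hb'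
    obtain ⟨k, F, hF, hsub⟩ := ih y hyx.lt _ hchain hmax
    refine ⟨k + 1, Fin.snoc F x, hF.snoc hyx, fun c hc => ?_⟩
    by_cases hcx : c = x
    · exact ⟨Fin.last _, by rw [Fin.snoc_last (α := fun _ => S), hcx]⟩
    · obtain ⟨i, hi⟩ := hsub (Finset.mem_coe.2
        (Finset.mem_insert_of_mem (Finset.mem_erase.2 ⟨hcx, hc⟩)))
      exact ⟨i.castSucc, by rw [Fin.snoc_castSucc (α := fun _ => S), hi]⟩

end Filtration

end GR

theorem stmt4 {S : Type*} {T : Type*} [PartialOrder S] [PartialOrder T] (l : S → T)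
    (hL1 : ∀ x y : S, x < y → l x < l y)
    (hL2 : ∀ x y : S, l x ≤ l y ∨ l y ≤ l x)
    (hL3 : ∀ y : S, {t : T | ∃ x : S, x ≤ y ∧ l x = t}.Finite)
    (x : S) :
    (∀ C : Finset S, GR.IsFinChain C → GR.HasMax C x →
      ∃ (k : ℕ) (F : Fin (k + 1) → S), GR.IsFiltrationOf F x ∧
        ↑C ⊆ Set.range F ∧
        GR.LexLE (C.image l) ((Finset.image F Finset.univ).image l)) ∧
    ∀ Z : Finset T,
      (Z ∈ GR.chainImages l x ∧ ∀ Z' ∈ GR.chainImages l x, GR.LexLE Z' Z) ↔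
      (Z ∈ GR.filtImages l x ∧ ∀ Z' ∈ GR.filtImages l x, GR.LexLE Z' Z) := by
  have hl : StrictMono l := fun a b => hL1 a b
  have key : ∀ C : Finset S, GR.IsFinChain C → GR.HasMax C x →
      ∃ (k : ℕ) (F : Fin (k + 1) → S), GR.IsFiltrationOf F x ∧ ↑C ⊆ Set.range F ∧
        C.image l ⊆ (Finset.image F Finset.univ).image l := by
    intro C hC hCx
    obtain ⟨k, F, hF, hsub⟩ := GR.exists_isFiltrationOf_of_isFinChain hl hL3 x C hC hCx
    refine ⟨k, F, hF, hsub, Finset.image_subset_image fun c hc => ?_⟩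
    obtain ⟨i, rfl⟩ := hsub hc
    exact Finset.mem_image_of_mem F (Finset.mem_univ i)
  refine ⟨fun C hC hCx => ?_, fun Z => ⟨?_, ?_⟩⟩
  · obtain ⟨k, F, hF, hsub, himg⟩ := key C hC hCx
    exact ⟨k, F, hF, hsub, GR.LexLE.of_subset himg⟩
  · rintro ⟨⟨C, hC, hCx, rfl⟩, hmax⟩
    obtain ⟨k, F, hF, -, himg⟩ := key C hC hCx
    have hmem : (Finset.image F Finset.univ).image l ∈ GR.filtImages l x := ⟨k, F, hF, rfl⟩
    have heq := GR.LexLE.antisymm_of_subset himg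
      (hmax _ (GR.filtImages_subset_chainImages l x hmem))
    exact ⟨heq ▸ hmem, fun Z' hZ' => hmax Z' (GR.filtImages_subset_chainImages l x hZ')⟩
  · rintro ⟨hZ, hmax⟩
    refine ⟨GR.filtImages_subset_chainImages l x hZ, ?_⟩
    rintro _ ⟨C, hC, hCx, rfl⟩
    obtain ⟨k, F, hF, -, himg⟩ := key C hC hCx
    exact GR.LexLE.mono_left himg (hmax _ ⟨k, F, hF, rfl⟩)
end

section
/- Let l : (S,≤) → (T,≲) be a length function between posets, i.e., l satisfies (L1) x < y implies l(x) < l(y), (L2) any two values of l are ≲-comparable, and (L3) for every y ∈ S the set {l(x') : x' ∈ S, x' ≤ y} is finite. Then for every x ∈ S the induced chain length function satisfies the recursion l*(x) = {l(x)} ∪ max_{≤_L} {l*(y) : y ∈ S, y < x}, where the union with the maximum is taken to be just {l(x)} if x is minimal. -/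
open scoped Classical

namespace GR

variable {S : Type*} {T : Type*} [PartialOrder S]

theorem insert_sdiff_insert_of_notMem {t : T} {A : Finset T} (B : Finset T) (hA : t ∉ A) :
    insert t A \ insert t B = A \ B := by
  ext s
  simp only [Finset.mem_sdiff, Finset.mem_insert]
  grind

/-- Removing a common element from both sets preserves and reflects the lexicographic order. -/
theorem lexLE_insert_iff [PartialOrder T] {t : T} {A B : Finset T} (hA : t ∉ A) (hB : t ∉ B) :
    LexLE (insert t A) (insert t B) ↔ LexLE A B := by
  simp only [LexLE, insert_sdiff_insert_of_notMem _ hA, insert_sdiff_insert_of_notMem _ hB]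

theorem IsFinChain.exists_hasMax {C : Finset S} (hC : IsFinChain C) (hne : C.Nonempty) :
    ∃ y, HasMax C y := by
  obtain ⟨y, hy⟩ := C.exists_maximal hne
  exact ⟨y, hy.1, fun z hz => (hC z hz y hy.1).elim id fun h => hy.2 hz h⟩

theorem notMem_of_mem_chainImages [PartialOrder T] {l : S → T} (hl : StrictMono l) {x y : S}
    (hyx : y < x) {A : Finset T} (hA : A ∈ chainImages l y) : l x ∉ A := by
  obtain ⟨C, -, hmax, rfl⟩ := hA
  intro h
  obtain ⟨z, hz, hzx⟩ := Finset.mem_image.mp h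
  exact (hl ((hmax.2 z hz).trans_lt hyx)).ne hzx

theorem insert_mem_chainImages {l : S → T} {x y : S} (hyx : y < x) {A : Finset T}
    (hA : A ∈ chainImages l y) : insert (l x) A ∈ chainImages l x := by
  obtain ⟨C, hC, hmax, rfl⟩ := hA
  have hle : ∀ z ∈ C, z ≤ x := fun z hz => (hmax.2 z hz).trans hyx.le
  refine ⟨insert x C, ?_, ⟨Finset.mem_insert_self _ _, ?_⟩, Finset.image_insert _ _ _⟩
  · intro a ha b hb
    rcases Finset.mem_insert.mp ha with rfl | ha' <;>
      rcases Finset.mem_insert.mp hb with rfl | hb'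
    · exact Or.inl le_rfl
    · exact Or.inr (hle b hb')
    · exact Or.inl (hle a ha')
    · exact hC a ha' b hb'
  · intro z hz
    rcases Finset.mem_insert.mp hz with rfl | hz
    · exact le_rfl
    · exact hle z hz

theorem singleton_mem_chainImages (l : S → T) (x : S) : {l x} ∈ chainImages l x :=
  ⟨{x}, by simp [IsFinChain], by simp [HasMax], by simp⟩

/-- A chain with maximum `x` is `{x}`, or arises by adding `x` to a chain with a smaller maximum. -/
theorem eq_singleton_or_eq_insert_of_mem_chainImages {l : S → T} {x : S} {Z : Finset T}
    (hZ : Z ∈ chainImages l x) :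
    Z = {l x} ∨ ∃ y < x, ∃ W ∈ chainImages l y, Z = insert (l x) W := by
  obtain ⟨C, hC, hmax, rfl⟩ := hZ
  have hins : C.image l = insert (l x) ((C.erase x).image l) := by
    rw [← Finset.image_insert, Finset.insert_erase hmax.1]
  rcases (C.erase x).eq_empty_or_nonempty with h | h
  · left
    simp [hins, h]
  · right
    have hC' : IsFinChain (C.erase x) := fun a ha b hb =>
      hC a (Finset.mem_of_mem_erase ha) b (Finset.mem_of_mem_erase hb)
    obtain ⟨y, hy⟩ := hC'.exists_hasMax h
    exact ⟨y, (hmax.2 y (Finset.mem_of_mem_erase hy.1)).lt_of_ne (Finset.ne_of_mem_erase hy.1),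
      _, ⟨_, hC', hy, rfl⟩, hins⟩

end GR

theorem stmt5 {S : Type*} {T : Type*} [PartialOrder S] [PartialOrder T] (l : S → T)
    (hL1 : ∀ x y : S, x < y → l x < l y)
    (hL2 : ∀ x y : S, l x ≤ l y ∨ l y ≤ l x)
    (hL3 : ∀ y : S, {t : T | ∃ x : S, x ≤ y ∧ l x = t}.Finite)
    (x : S) (Z : Finset T) (hZ : GR.IsGRValue l x Z) :
    (IsMin x → Z = {l x}) ∧
    (¬ IsMin x →
      ∃ W : Finset T,
        (W ∈ {W' : Finset T | ∃ y : S, y < x ∧ GR.IsGRValue l y W'} ∧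
          ∀ W' ∈ {W' : Finset T | ∃ y : S, y < x ∧ GR.IsGRValue l y W'}, GR.LexLE W' W) ∧
        Z = insert (l x) W) := by
  have hl : StrictMono l := fun a b => hL1 a b
  have hcases := GR.eq_singleton_or_eq_insert_of_mem_chainImages hZ.1
  refine ⟨fun hmin => hcases.resolve_right ?_, fun hmin => ?_⟩
  · rintro ⟨y, hy, -⟩
    exact hmin.not_lt hy
  · obtain ⟨y, hyx, W, hW, rfl⟩ := hcases.resolve_left (by
      rintro rfl
      obtain ⟨y, hyx⟩ := not_isMin_iff.mp hmin
      have h := hZ.2 _ (GR.insert_mem_chainImages hyx (GR.singleton_mem_chainImages l y))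
      have hne : l y ≠ l x := (hl hyx).ne
      rcases h with h | ⟨t, ht, -⟩
      · have : l y ∈ ({l x, l y} : Finset T) \ {l x} := by simp [hne]
        simp [h] at this
      · simp only [Finset.mem_sdiff, Finset.mem_insert, Finset.mem_singleton] at ht
        exact ht.2 (Or.inl ht.1))
    have hmax : ∀ y' < x, ∀ A ∈ GR.chainImages l y', GR.LexLE A W := fun y' hy' A hA =>
      (GR.lexLE_insert_iff (GR.notMem_of_mem_chainImages hl hy' hA)
        (GR.notMem_of_mem_chainImages hl hyx hW)).mp
        (hZ.2 _ (GR.insert_mem_chainImages hy' hA))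
    refine ⟨W, ⟨⟨y, hyx, hW, hmax y hyx⟩, ?_⟩, rfl⟩
    rintro W' ⟨y', hy', hW'⟩
    exact hmax y' hy' W' hW'.1
end

section
/- Let Q be a finite acyclic quiver, K a field, and M a nonzero thin representation of Q. Then M is indecomposable (M is not isomorphic to a direct sum N ⊕ N' of two nonzero representations) if and only if the support supp(M) is a connected quiver, i.e., any two vertices of supp(M) are joined by a walk using arrows of supp(M). -/
open scoped Classical

namespace QR

/-- A finite quiver: finite sets of vertices and arrows with source and target maps. -/
structure FinQuiver where
  V : Type
  A : Type
  [fintypeV : Fintype V]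
  [fintypeA : Fintype A]
  s : A → V
  t : A → V

attribute [instance] FinQuiver.fintypeV FinQuiver.fintypeA

/-- One oriented step along an arrow of `Q`. -/
def FinQuiver.Step (Q : FinQuiver) (v w : Q.V) : Prop := ∃ a : Q.A, Q.s a = v ∧ Q.t a = w

/-- `Q` is acyclic: it contains no oriented cycle. -/
def FinQuiver.Acyclic (Q : FinQuiver) : Prop := ∀ v : Q.V, ¬ Relation.TransGen Q.Step v v

/-- A finite-dimensional `K`-linear representation of the quiver `Q`. -/
structure Rep (K : Type) [Field K] (Q : FinQuiver) where
  space : Q.V → Type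
  [instAddCommGroup : ∀ v, AddCommGroup (space v)]
  [instModule : ∀ v, Module K (space v)]
  [instFinite : ∀ v, FiniteDimensional K (space v)]
  map : ∀ a : Q.A, space (Q.s a) →ₗ[K] space (Q.t a)

attribute [instance] Rep.instAddCommGroup Rep.instModule Rep.instFinite

variable {K : Type} [Field K] {Q : FinQuiver}

/-- A morphism of representations: linear maps commuting with the structure maps. -/
structure Hom (N M : Rep K Q) where
  app : ∀ v, N.space v →ₗ[K] M.space v
  comm : ∀ a : Q.A, (M.map a).comp (app (Q.s a)) = (app (Q.t a)).comp (N.map a)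

/-- Composition of morphisms of representations. -/
def Hom.comp {X Y Z : Rep K Q} (g : Hom Y Z) (f : Hom X Y) : Hom X Z where
  app v := (g.app v).comp (f.app v)
  comm a := by
    ext x
    have h1 := LinearMap.congr_fun (f.comm a) x
    have h2 := LinearMap.congr_fun (g.comm a) (f.app (Q.s a) x)
    simp only [LinearMap.comp_apply] at h1 h2 ⊢
    rw [h2, h1]

/-- A representation is nonzero if some vertex space contains a nonzero vector. -/
def Rep.Nonzero (M : Rep K Q) : Prop := ∃ v, ∃ x : M.space v, x ≠ 0

/-- A representation is zero if all its vertex spaces are trivial. -/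
def IsZeroRep (M : Rep K Q) : Prop := ∀ v, ∀ x : M.space v, x = 0

/-- Two representations are isomorphic iff there is a morphism between them that is
bijective at every vertex. -/
def Iso (N M : Rep K Q) : Prop := ∃ f : Hom N M, ∀ v, Function.Bijective (f.app v)

/-- The direct sum of two representations. -/
noncomputable def dsum (N N' : Rep K Q) : Rep K Q where
  space v := N.space v × N'.space v
  map a := (N.map a).prodMap (N'.map a)

/-- A representation is indecomposable if it is nonzero and not isomorphic to the
direct sum of two nonzero representations. -/
def Indecomposable (M : Rep K Q) : Prop :=
  M.Nonzero ∧ ¬ ∃ N N' : Rep K Q, N.Nonzero ∧ N'.Nonzero ∧ Iso M (dsum N N')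

/-- A representation is thin if all its vertex spaces have dimension at most one. -/
def Rep.Thin (M : Rep K Q) : Prop := ∀ v, Module.finrank K (M.space v) ≤ 1

/-- Vertices of the support of `M`. -/
def suppV (M : Rep K Q) : Set Q.V := {v | ∃ x : M.space v, x ≠ 0}

/-- Arrows of the support of `M`. -/
def suppA (M : Rep K Q) : Set Q.A := {a | M.map a ≠ 0}

/-- Two vertices are adjacent in the underlying graph of the subquiver with arrow set
`SA` if some arrow of `SA` joins them (in either direction). -/
def AdjIn (Q : FinQuiver) (SA : Set Q.A) (v w : Q.V) : Prop :=
  ∃ a ∈ SA, (Q.s a = v ∧ Q.t a = w) ∨ (Q.s a = w ∧ Q.t a = v)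

/-- The subquiver with vertex set `SV` and arrow set `SA` is connected: any two of its
vertices are joined by a walk using its arrows. -/
def ConnectedOn (Q : FinQuiver) (SV : Set Q.V) (SA : Set Q.A) : Prop :=
  ∀ v ∈ SV, ∀ w ∈ SV, Relation.ReflTransGen (AdjIn Q SA) v w

/-- The underlying graph of the subquiver with arrow set `SA` contains a cycle:
there are pairwise distinct arrows `e 0, …, e n` in `SA` and pairwise distinct
vertices `v 0, …, v n` such that `e i` joins `v i` and `v (i+1)` (cyclically,
in either direction). -/
def HasCycle (Q : FinQuiver) (SA : Set Q.A) : Prop :=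
  ∃ (n : ℕ) (e : Fin (n + 1) → Q.A) (v : Fin (n + 1) → Q.V),
    Function.Injective e ∧ (∀ i, e i ∈ SA) ∧ Function.Injective v ∧
    ∀ i : Fin (n + 1), (Q.s (e i) = v i ∧ Q.t (e i) = v (i + 1)) ∨
      (Q.s (e i) = v (i + 1) ∧ Q.t (e i) = v i)

/-- The underlying graph of the subquiver `(SV, SA)` is a tree:
nonempty, connected and with no cycles. -/
def IsTreeOn (Q : FinQuiver) (SV : Set Q.V) (SA : Set Q.A) : Prop :=
  SV.Nonempty ∧ ConnectedOn Q SV SA ∧ ¬ HasCycle Q SA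

/-- The underlying graph of the subquiver `(SV, SA)` is a cycle on `n + 1 ≥ 2` vertices. -/
def IsCycleOn (Q : FinQuiver) (SV : Set Q.V) (SA : Set Q.A) : Prop :=
  ∃ n : ℕ, 0 < n ∧ ∃ (ev : Fin (n + 1) → Q.V) (ea : Fin (n + 1) → Q.A),
    Function.Injective ev ∧ Function.Injective ea ∧
    SV = Set.range ev ∧ SA = Set.range ea ∧
    ∀ i : Fin (n + 1), (Q.s (ea i) = ev i ∧ Q.t (ea i) = ev (i + 1)) ∨
      (Q.s (ea i) = ev (i + 1) ∧ Q.t (ea i) = ev i)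

/-- The canonical representation of the subquiver `(SV, SA)`: the field `K` at the
vertices of `SV`, zero elsewhere, identity maps on the arrows of `SA` (realised as
submodules of `K` and inclusions), zero maps elsewhere. -/
noncomputable def canonical (K : Type) [Field K] (Q : FinQuiver)
    (SV : Set Q.V) (SA : Set Q.A) : Rep K Q where
  space v := ↥(if v ∈ SV then (⊤ : Submodule K K) else ⊥)
  map a :=
    if a ∈ SA then
      (if h : (if Q.s a ∈ SV then (⊤ : Submodule K K) else ⊥) ≤
          (if Q.t a ∈ SV then (⊤ : Submodule K K) else ⊥)
        then Submodule.inclusion h else 0)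
    else 0

/-- The simple representation `S(i)`. -/
noncomputable def simple (K : Type) [Field K] (Q : FinQuiver) (i : Q.V) : Rep K Q :=
  canonical K Q {i} ∅

/-- A family of submodules of the vertex spaces of `M` is a subrepresentation if it is
closed under the structure maps. -/
def IsSubRep (M : Rep K Q) (p : ∀ v, Submodule K (M.space v)) : Prop :=
  ∀ a : Q.A, ∀ x ∈ p (Q.s a), M.map a x ∈ p (Q.t a)

/-- The representation carried by a subrepresentation of `M`. -/
noncomputable def restrictRep (M : Rep K Q) (p : ∀ v, Submodule K (M.space v)) : Rep K Q where
  space v := ↥(p v)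
  map a :=
    if h : ∀ x ∈ p (Q.s a), M.map a x ∈ p (Q.t a) then (M.map a).restrict h else 0

/-- The quotient representation `M / p`. -/
noncomputable def quotRep (M : Rep K Q) (p : ∀ v, Submodule K (M.space v)) : Rep K Q where
  space v := M.space v ⧸ p v
  map a :=
    if h : p (Q.s a) ≤ (p (Q.t a)).comap (M.map a) then
      Submodule.mapQ (p (Q.s a)) (p (Q.t a)) (M.map a) h
    else 0

/-- A length function on the category of finite-dimensional `K`-representations of `Q`:
nonnegative real valued, zero exactly on the zero representations, and additive on
short exact sequences. -/
def LengthFunction (l : Rep K Q → ℝ) : Prop :=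
  (∀ X, 0 ≤ l X) ∧ (∀ X, l X = 0 ↔ IsZeroRep X) ∧
    ∀ (X Y Z : Rep K Q) (f : Hom X Y) (g : Hom Y Z),
      (∀ v, Function.Injective (f.app v)) →
      (∀ v, Function.Surjective (g.app v)) →
      (∀ v, LinearMap.range (f.app v) = LinearMap.ker (g.app v)) →
      l Y = l X + l Z


/-- The lexicographic order on finite chains (= finite subsets) of `ℝ`:
`X ≤ₗ Y` iff `min (Y \ X) ≤ min (X \ Y)`, with the convention `min ∅ = ∞`. -/
def RLexLE (X Y : Finset ℝ) : Prop := (Y \ X).min ≤ (X \ Y).min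

/-- `p` is an indecomposable subrepresentation of `M`. -/
def IndecSub (M : Rep K Q) (p : ∀ v, Submodule K (M.space v)) : Prop :=
  IsSubRep M p ∧ Indecomposable (restrictRep M p)

/-- `C` is a finite chain of indecomposable subrepresentations of `M`. -/
def IndecChain (M : Rep K Q) (C : Finset (∀ v, Submodule K (M.space v))) : Prop :=
  (∀ p ∈ C, IndecSub M p) ∧ ∀ p ∈ C, ∀ q ∈ C, p ≤ q ∨ q ≤ p

/-- The values of the length function `l` on the members of a chain of
subrepresentations of `M`. -/
noncomputable def chainL (l : Rep K Q → ℝ) (M : Rep K Q)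
    (C : Finset (∀ v, Submodule K (M.space v))) : Finset ℝ :=
  C.image fun p => l (restrictRep M p)

/-- An indecomposable filtration of `M`: a chain of indecomposable subrepresentations,
starting at a minimal (i.e. simple) one, each a direct predecessor of the next in the
poset of indecomposable subrepresentations, and ending at `M` itself. -/
def IndecFiltration (M : Rep K Q) {m : ℕ}
    (𝒩 : Fin (m + 1) → ∀ v, Submodule K (M.space v)) : Prop :=
  (∀ i, IndecSub M (𝒩 i)) ∧
  (∀ r, IndecSub M r → r ≤ 𝒩 0 → r = 𝒩 0) ∧
  (∀ i : Fin m, 𝒩 i.castSucc ≤ 𝒩 i.succ ∧ 𝒩 i.castSucc ≠ 𝒩 i.succ ∧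
    ∀ r, IndecSub M r → 𝒩 i.castSucc ≤ r → r ≤ 𝒩 i.succ →
      r = 𝒩 i.castSucc ∨ r = 𝒩 i.succ) ∧
  𝒩 (Fin.last m) = fun _ => ⊤

/-- `Z` is the Gabriel-Roiter measure `μ_l(M)`: the lexicographically greatest element of
the set of `l`-values of finite chains of indecomposable subrepresentations of `M`
with maximum `M`. -/
def IsGRMeasure (l : Rep K Q → ℝ) (M : Rep K Q) (Z : Finset ℝ) : Prop :=
  (∃ C, IndecChain M C ∧ (fun _ => (⊤ : Submodule K _)) ∈ C ∧ chainL l M C = Z) ∧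
  ∀ C, IndecChain M C → (fun _ => (⊤ : Submodule K _)) ∈ C → RLexLE (chainL l M C) Z

/-- `𝒩` is a GR filtration of `M` with respect to `l`: an indecomposable filtration
whose chain of `l`-values attains the Gabriel-Roiter measure of `M`. -/
def IsGRFiltration (l : Rep K Q → ℝ) (M : Rep K Q) {m : ℕ}
    (𝒩 : Fin (m + 1) → ∀ v, Submodule K (M.space v)) : Prop :=
  IndecFiltration M 𝒩 ∧
    ∀ C, IndecChain M C → (fun _ => (⊤ : Submodule K _)) ∈ C →
      RLexLE (chainL l M C) (chainL l M (Finset.image 𝒩 Finset.univ))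

/-- `(SV, SA)` is a subquiver of `Q`: arrows of `SA` have their endpoints in `SV`. -/
def IsSubquiver (Q : FinQuiver) (P : Set Q.V × Set Q.A) : Prop :=
  ∀ a ∈ P.2, Q.s a ∈ P.1 ∧ Q.t a ∈ P.1

/-- `P` is a member of `ℒ(Q)`, the poset of connected nonempty subquivers of `Q`. -/
def InL (Q : FinQuiver) (P : Set Q.V × Set Q.A) : Prop :=
  IsSubquiver Q P ∧ P.1.Nonempty ∧ ConnectedOn Q P.1 P.2

/-- The order `≤_C` on subquivers: `P` is a subquiver of `P'` and every arrow of `P'`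
whose source lies in `P` also has its target in `P`. -/
def leC (Q : FinQuiver) (P P' : Set Q.V × Set Q.A) : Prop :=
  P.1 ⊆ P'.1 ∧ P.2 ⊆ P'.2 ∧ ∀ a ∈ P'.2, Q.s a ∈ P.1 → Q.t a ∈ P.1

/-- The total weight of the vertices of a subquiver. -/
noncomputable def qweight (w : Q.V → ℝ) (P : Set Q.V × Set Q.A) : ℝ :=
  ∑ v : Q.V, if v ∈ P.1 then w v else 0

/-- `C` is a finite chain in the poset `ℒ(Q)`. -/
def LChain (Q : FinQuiver) (C : Finset (Set Q.V × Set Q.A)) : Prop :=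
  (∀ P ∈ C, InL Q P) ∧ ∀ P ∈ C, ∀ P' ∈ C, leC Q P P' ∨ leC Q P' P

/-- The weights of the members of a chain of subquivers. -/
noncomputable def qchainW (w : Q.V → ℝ) (C : Finset (Set Q.V × Set Q.A)) : Finset ℝ :=
  C.image (qweight w)

/-- A filtration in the poset `ℒ(Q)`: starting at a minimal connected subquiver, each
member a direct predecessor of the next one. -/
def LFiltration (Q : FinQuiver) {m : ℕ} (𝒬 : Fin (m + 1) → Set Q.V × Set Q.A) : Prop :=
  (∀ i, InL Q (𝒬 i)) ∧
  (∀ P, InL Q P → leC Q P (𝒬 0) → P = 𝒬 0) ∧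
  ∀ i : Fin m, leC Q (𝒬 i.castSucc) (𝒬 i.succ) ∧ 𝒬 i.castSucc ≠ 𝒬 i.succ ∧
    ∀ P, InL Q P → leC Q (𝒬 i.castSucc) P → leC Q P (𝒬 i.succ) →
      P = 𝒬 i.castSucc ∨ P = 𝒬 i.succ

/-- `Z` is the value `w*(P₀)` of the induced chain length function of the weight
function `w` in the poset `ℒ(Q)`. -/
def IsWStar (Q : FinQuiver) (w : Q.V → ℝ) (P₀ : Set Q.V × Set Q.A) (Z : Finset ℝ) : Prop :=
  (∃ C, LChain Q C ∧ (P₀ ∈ C ∧ ∀ P ∈ C, leC Q P P₀) ∧ qchainW w C = Z) ∧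
  ∀ C, LChain Q C → (P₀ ∈ C ∧ ∀ P ∈ C, leC Q P P₀) → RLexLE (qchainW w C) Z

/-- `𝒬` is a `w*`-filtration of `P₀` in the poset `ℒ(Q)`. -/
def IsWStarLFiltration (Q : FinQuiver) (w : Q.V → ℝ) {m : ℕ}
    (𝒬 : Fin (m + 1) → Set Q.V × Set Q.A) (P₀ : Set Q.V × Set Q.A) : Prop :=
  LFiltration Q 𝒬 ∧ 𝒬 (Fin.last m) = P₀ ∧
    ∀ C, LChain Q C → (P₀ ∈ C ∧ ∀ P ∈ C, leC Q P P₀) →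
      RLexLE (qchainW w C) (qchainW w (Finset.image 𝒬 Finset.univ))

/-- `E` is an injective object in the category of finite-dimensional
`K`-representations of `Q`. -/
def InjectiveRep (E : Rep K Q) : Prop :=
  ∀ (X Y : Rep K Q) (f : Hom X Y), (∀ v, Function.Injective (f.app v)) →
    ∀ g : Hom X E, ∃ h : Hom Y E, Hom.comp h f = g

end QR

namespace QR

variable {K : Type} [Field K] {Q : FinQuiver}

/-- In a direct sum isomorphic to a thin representation, the two summands are never both nonzero
at the same vertex. -/
theorem Rep.Thin.eq_zero_or_eq_zero_of_iso_dsum {M N N' : Rep K Q} (hM : M.Thin)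
    (h : Iso M (dsum N N')) {v : Q.V} (x : N.space v) (y : N'.space v) : x = 0 ∨ y = 0 := by
  obtain ⟨f, hf⟩ := h
  obtain ⟨m, hm⟩ := finrank_le_one_iff.mp (hM v)
  obtain ⟨m₁, hm₁⟩ := (hf v).2 ((x, 0) : N.space v × N'.space v)
  obtain ⟨m₂, hm₂⟩ := (hf v).2 ((0, y) : N.space v × N'.space v)
  obtain ⟨c, rfl⟩ := hm m₁
  obtain ⟨d, rfl⟩ := hm m₂
  rw [map_smul] at hm₁ hm₂
  have hx : c • (f.app v m).1 = x := congrArg Prod.fst hm₁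
  have hc : c • (f.app v m).2 = 0 := congrArg Prod.snd hm₁
  have hy : d • (f.app v m).2 = y := congrArg Prod.snd hm₂
  rcases smul_eq_zero.mp hc with hc | hc
  · left
    rw [← hx, hc, zero_smul]
  · right
    rw [← hy, hc, smul_zero]

/-- The ends of a support arrow lie in the support. -/
theorem mem_suppV_of_mem_suppA {M : Rep K Q} {a : Q.A} (ha : a ∈ suppA M) :
    Q.s a ∈ suppV M ∧ Q.t a ∈ suppV M := by
  obtain ⟨x, hx⟩ : ∃ x, M.map a x ≠ 0 := by
    by_contra! h
    exact ha (LinearMap.ext h)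
  exact ⟨⟨x, fun h => hx (by rw [h, map_zero])⟩, ⟨_, hx⟩⟩

/-- A support arrow of a direct sum is a support arrow of one of the summands. -/
theorem mem_suppA_of_iso_dsum {M N N' : Rep K Q} (h : Iso M (dsum N N')) {a : Q.A}
    (ha : a ∈ suppA M) : a ∈ suppA N ∨ a ∈ suppA N' := by
  obtain ⟨f, hf⟩ := h
  by_contra! hN
  have h₁ : N.map a = 0 := not_not.mp hN.1
  have h₂ : N'.map a = 0 := not_not.mp hN.2
  have h₀ : (dsum N N').map a = 0 := by
    change (N.map a).prodMap (N'.map a) = 0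
    rw [h₁, h₂, LinearMap.prodMap_zero]
  refine ha (LinearMap.ext fun x => (hf (Q.t a)).1 ?_)
  have hx := LinearMap.congr_fun (f.comm a) x
  rw [h₀] at hx
  simpa using hx.symm

/-- For a direct sum decomposition of a thin representation, the support of a summand contains
either both ends of a support arrow or none. -/
theorem Rep.Thin.mem_suppV_iff_of_iso_dsum {M N N' : Rep K Q} (hM : M.Thin)
    (h : Iso M (dsum N N')) {a : Q.A} (ha : a ∈ suppA M) :
    Q.s a ∈ suppV N ↔ Q.t a ∈ suppV N := by
  have disjoint {v : Q.V} (hN' : v ∈ suppV N') : v ∉ suppV N := by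
    rintro ⟨x, hx⟩
    obtain ⟨y, hy⟩ := hN'
    exact (hM.eq_zero_or_eq_zero_of_iso_dsum h x y).elim hx hy
  rcases mem_suppA_of_iso_dsum h ha with ha | ha
  · exact iff_of_true (mem_suppV_of_mem_suppA ha).1 (mem_suppV_of_mem_suppA ha).2
  · exact iff_of_false (disjoint (mem_suppV_of_mem_suppA ha).1)
      (disjoint (mem_suppV_of_mem_suppA ha).2)

/-- A thin representation with connected support is not a direct sum of nonzero
representations. -/
theorem Rep.Thin.not_iso_dsum_of_connectedOn {M N N' : Rep K Q} (hM : M.Thin)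
    (hc : ConnectedOn Q (suppV M) (suppA M)) (hN : N.Nonzero) (hN' : N'.Nonzero) :
    ¬ Iso M (dsum N N') := by
  intro h
  obtain ⟨v, x, hx⟩ := hN
  obtain ⟨w, y, hy⟩ := hN'
  have mem_suppV {u : Q.V} (z : N.space u × N'.space u) (hz : z ≠ 0) : u ∈ suppV M := by
    obtain ⟨f, hf⟩ := h
    obtain ⟨m, hm⟩ := (hf u).2 z
    refine ⟨m, fun hm₀ => hz ?_⟩
    rw [← hm, hm₀]
    exact map_zero (f.app u)
  have hv : v ∈ suppV M := mem_suppV (x, 0) fun h => hx (congrArg Prod.fst h)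
  have hw : w ∈ suppV M := mem_suppV (0, y) fun h => hy (congrArg Prod.snd h)
  have hwN : w ∈ suppV N := by
    have hvw := hc v hv w hw
    clear hw hy y
    induction hvw with
    | refl => exact ⟨x, hx⟩
    | tail _ hstep ih =>
      obtain ⟨a, ha, ⟨rfl, rfl⟩ | ⟨rfl, rfl⟩⟩ := hstep
      · exact (hM.mem_suppV_iff_of_iso_dsum h ha).mp ih
      · exact (hM.mem_suppV_iff_of_iso_dsum h ha).mpr ih
  obtain ⟨z, hz⟩ := hwN
  exact (hM.eq_zero_or_eq_zero_of_iso_dsum h z y).elim hz hy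

/-- The submodules of `M` concentrated at the vertices of `S`. -/
noncomputable def suppSub (M : Rep K Q) (S : Set Q.V) (v : Q.V) : Submodule K (M.space v) :=
  if v ∈ S then ⊤ else ⊥

theorem suppSub_of_mem {M : Rep K Q} {S : Set Q.V} {v : Q.V} (h : v ∈ S) :
    suppSub M S v = ⊤ := if_pos h

theorem suppSub_of_notMem {M : Rep K Q} {S : Set Q.V} {v : Q.V} (h : v ∉ S) :
    suppSub M S v = ⊥ := if_neg h

theorem isSubRep_suppSub {M : Rep K Q} {S : Set Q.V}
    (hS : ∀ a ∈ suppA M, Q.s a ∈ S → Q.t a ∈ S) : IsSubRep M (suppSub M S) := by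
  intro a x hx
  by_cases ha : a ∈ suppA M
  · by_cases hs : Q.s a ∈ S
    · rw [suppSub_of_mem (hS a ha hs)]
      trivial
    · rw [suppSub_of_notMem hs, Submodule.mem_bot] at hx
      rw [hx, map_zero]
      exact zero_mem _
  · rw [show M.map a = 0 from not_not.mp ha]
    exact zero_mem _

theorem nonzero_restrictRep_suppSub {M : Rep K Q} {S : Set Q.V} {v : Q.V} (hv : v ∈ suppV M)
    (hS : v ∈ S) : (restrictRep M (suppSub M S)).Nonzero := by
  obtain ⟨x, hx⟩ := hv
  have hmem : x ∈ suppSub M S v := by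
    rw [suppSub_of_mem hS]
    trivial
  exact ⟨v, (⟨x, hmem⟩ : suppSub M S v), fun h => hx (congrArg Subtype.val h)⟩

theorem restrictRep_map_coe {M : Rep K Q} {p : ∀ v, Submodule K (M.space v)}
    (hp : IsSubRep M p) (a : Q.A) (x : p (Q.s a)) :
    ((restrictRep M p).map a x : p (Q.t a)).1 = M.map a x.1 := by
  have h : (restrictRep M p).map a = (M.map a).restrict (hp a) := dif_pos (hp a)
  rw [h]
  rfl

/-- Complementary subrepresentations decompose `M` as a direct sum: if `M.space v` is the
internal direct sum of `p v` and `q v` at every vertex, then `M` is isomorphic to the direct sum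
of the two restrictions. -/
theorem iso_dsum_restrictRep {M : Rep K Q} {p q : ∀ v, Submodule K (M.space v)}
    (hp : IsSubRep M p) (hq : IsSubRep M q) (h : ∀ v, IsCompl (p v) (q v)) :
    Iso M (dsum (restrictRep M p) (restrictRep M q)) := by
  let e (v : Q.V) : (p v × q v) ≃ₗ[K] M.space v := Submodule.prodEquivOfIsCompl _ _ (h v)
  refine ⟨⟨fun v => (e v).symm.toLinearMap, fun a => LinearMap.ext fun x => ?_⟩,
    fun v => (e v).symm.bijective⟩
  obtain ⟨z, rfl⟩ := (e (Q.s a)).surjective x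
  refine (e (Q.t a)).injective ?_
  change e (Q.t a) ((restrictRep M p).map a ((e (Q.s a)).symm (e (Q.s a) z)).1,
      (restrictRep M q).map a ((e (Q.s a)).symm (e (Q.s a) z)).2) =
    e (Q.t a) ((e (Q.t a)).symm (M.map a (e (Q.s a) z)))
  rw [LinearEquiv.symm_apply_apply, LinearEquiv.apply_symm_apply]
  change ((restrictRep M p).map a z.1 : p (Q.t a)).1 +
    ((restrictRep M q).map a z.2 : q (Q.t a)).1 = M.map a (z.1.1 + z.2.1)
  rw [restrictRep_map_coe hp, restrictRep_map_coe hq, map_add]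

theorem isCompl_suppSub_compl (M : Rep K Q) (S : Set Q.V) (v : Q.V) :
    IsCompl (suppSub M S v) (suppSub M Sᶜ v) := by
  by_cases hv : v ∈ S
  · rw [suppSub_of_mem hv, suppSub_of_notMem (not_not.mpr hv)]
    exact isCompl_top_bot
  · rw [suppSub_of_notMem hv, suppSub_of_mem hv]
    exact isCompl_bot_top

/-- A representation with disconnected support is a direct sum of two nonzero
representations. -/
theorem exists_iso_dsum_of_not_connectedOn {M : Rep K Q}
    (h : ¬ ConnectedOn Q (suppV M) (suppA M)) :
    ∃ N N' : Rep K Q, N.Nonzero ∧ N'.Nonzero ∧ Iso M (dsum N N') := by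
  unfold ConnectedOn at h
  push Not at h
  obtain ⟨v, hv, w, hw, hvw⟩ := h
  let S : Set Q.V := {u | Relation.ReflTransGen (AdjIn Q (suppA M)) v u}
  have hS : ∀ a ∈ suppA M, Q.s a ∈ S → Q.t a ∈ S := fun a ha hs =>
    hs.tail ⟨a, ha, Or.inl ⟨rfl, rfl⟩⟩
  have hS' : ∀ a ∈ suppA M, Q.s a ∈ Sᶜ → Q.t a ∈ Sᶜ := fun a ha hs ht =>
    hs (ht.tail ⟨a, ha, Or.inr ⟨rfl, rfl⟩⟩)
  exact ⟨_, _, nonzero_restrictRep_suppSub hv (S := S) Relation.ReflTransGen.refl,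
    nonzero_restrictRep_suppSub hw (S := Sᶜ) hvw,
    iso_dsum_restrictRep (isSubRep_suppSub hS) (isSubRep_suppSub hS') (isCompl_suppSub_compl M S)⟩

end QR

theorem stmt6 (K : Type) [Field K] (Q : QR.FinQuiver) (hQ : Q.Acyclic)
    (M : QR.Rep K Q) (hthin : M.Thin) (hnz : M.Nonzero) :
    (¬ ∃ N N' : QR.Rep K Q, N.Nonzero ∧ N'.Nonzero ∧ QR.Iso M (QR.dsum N N')) ↔
      QR.ConnectedOn Q (QR.suppV M) (QR.suppA M) := by
  refine ⟨fun h => not_not.mp fun hc => h (QR.exists_iso_dsum_of_not_connectedOn hc), ?_⟩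
  rintro hc ⟨N, N', hN, hN', h⟩
  exact hthin.not_iso_dsum_of_connectedOn hc hN hN' h
end
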